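/- The space of quantum characters qChar(U) is a free module of rank one over the center Z(U) with basis the right integral μ: the ℂ-linear map from Z(U) to qChar(U) sending a central element z to the functional x ↦ μ(z x) is bijective. -/

import Mathlib

open scoped TensorProduct
open Finset

noncomputable section

namespace LogHennings

/-- `q = exp(iπ/p)`. -/
def qq (p : ℕ) : ℂ := Complex.exp ((Real.pi : ℂ) * Complex.I / (p : ℂ))

/-- `q^{1/2} = exp(iπ/(2p))`. -/
def qh (p : ℕ) : ℂ := Complex.exp ((Real.pi : ℂ) * Complex.I / (2 * (p : ℂ)))

/-- quantum integer `[m] = (q^m - q^{-m})/(q - q⁻¹)`. -/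
def qnum (p m : ℕ) : ℂ := ((qq p) ^ m - (qq p)⁻¹ ^ m) / (qq p - (qq p)⁻¹)

/-- quantum factorial `[m]! = [m][m-1]⋯[1]`. -/
def qfac (p : ℕ) : ℕ → ℂ
  | 0 => 1
  | m + 1 => qnum p (m + 1) * qfac p m

/-- Generators of the restricted quantum group `U`. -/
inductive UGen | E | F | K | Kinv

abbrev FU := FreeAlgebra ℂ UGen

def fE : FU := FreeAlgebra.ι ℂ UGen.E
def fF : FU := FreeAlgebra.ι ℂ UGen.F
def fK : FU := FreeAlgebra.ι ℂ UGen.K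
def fKinv : FU := FreeAlgebra.ι ℂ UGen.Kinv

/-- Defining relations of the restricted quantum group `U`. -/
inductive URel (p : ℕ) : FU → FU → Prop
  | Epow : URel p (fE ^ p) 0
  | Fpow : URel p (fF ^ p) 0
  | Kpow : URel p (fK ^ (2 * p)) 1
  | KKinv : URel p (fK * fKinv) 1
  | KinvK : URel p (fKinv * fK) 1
  | KE : URel p (fK * fE * fKinv) ((qq p) ^ 2 • fE)
  | KF : URel p (fK * fF * fKinv) (((qq p) ^ 2)⁻¹ • fF)
  | EF : URel p (fE * fF - fF * fE) ((qq p - (qq p)⁻¹)⁻¹ • (fK - fKinv))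

/-- The restricted quantum group `U = \bar U_q(sl2)`. -/
abbrev Uq (p : ℕ) := RingQuot (URel p)

def UE (p : ℕ) : Uq p := RingQuot.mkAlgHom ℂ (URel p) fE
def UF (p : ℕ) : Uq p := RingQuot.mkAlgHom ℂ (URel p) fF
def UK (p : ℕ) : Uq p := RingQuot.mkAlgHom ℂ (URel p) fK
def UKinv (p : ℕ) : Uq p := RingQuot.mkAlgHom ℂ (URel p) fKinv

/-- Generators of the braided extension `D`. -/
inductive DGen | e | phi | k | kinv

abbrev FD := FreeAlgebra ℂ DGen

def fe : FD := FreeAlgebra.ι ℂ DGen.e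
def fphi : FD := FreeAlgebra.ι ℂ DGen.phi
def fk : FD := FreeAlgebra.ι ℂ DGen.k
def fkinv : FD := FreeAlgebra.ι ℂ DGen.kinv

/-- Defining relations of `D`. -/
inductive DRel (p : ℕ) : FD → FD → Prop
  | epow : DRel p (fe ^ p) 0
  | phipow : DRel p (fphi ^ p) 0
  | kpow : DRel p (fk ^ (4 * p)) 1
  | kkinv : DRel p (fk * fkinv) 1
  | kinvk : DRel p (fkinv * fk) 1
  | ke : DRel p (fk * fe * fkinv) (qq p • fe)
  | kphi : DRel p (fk * fphi * fkinv) ((qq p)⁻¹ • fphi)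
  | ephi : DRel p (fe * fphi - fphi * fe)
      ((qq p - (qq p)⁻¹)⁻¹ • (fk ^ 2 - fkinv ^ 2))

/-- The braided extension `D` of `U`. -/
abbrev Dq (p : ℕ) := RingQuot (DRel p)

def De (p : ℕ) : Dq p := RingQuot.mkAlgHom ℂ (DRel p) fe
def Dphi (p : ℕ) : Dq p := RingQuot.mkAlgHom ℂ (DRel p) fphi
def Dk (p : ℕ) : Dq p := RingQuot.mkAlgHom ℂ (DRel p) fk
def Dkinv (p : ℕ) : Dq p := RingQuot.mkAlgHom ℂ (DRel p) fkinv

/-- The `R`-matrix of `D`. -/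
def Rmat (p : ℕ) : Dq p ⊗[ℂ] Dq p :=
  ((4 * (p : ℂ))⁻¹) •
    ∑ m ∈ range p, ∑ n ∈ range (4 * p), ∑ j ∈ range (4 * p),
      (((qq p - (qq p)⁻¹) ^ m / qfac p m) *
          (qh p) ^ ((m : ℤ) * ((m : ℤ) - 1) + 2 * (m : ℤ) * ((n : ℤ) - (j : ℤ))
            - (n : ℤ) * (j : ℤ))) •
        ((De p ^ m * Dk p ^ n) ⊗ₜ[ℂ] (Dphi p ^ m * Dk p ^ j))

/-- `R₂₁ = τ(R)`. -/
def R21 (p : ℕ) : Dq p ⊗[ℂ] Dq p := TensorProduct.comm ℂ (Dq p) (Dq p) (Rmat p)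

/-- The monodromy `M = R₂₁ R`. -/
def Mmat (p : ℕ) : Dq p ⊗[ℂ] Dq p := R21 p * Rmat p

/-- The ribbon element `r ∈ D`. -/
def rib (p : ℕ) : Dq p :=
  ((1 - Complex.I) / (2 * (Real.sqrt p : ℂ))) •
    ∑ m ∈ range p, ∑ j ∈ range (2 * p),
      (((qq p - (qq p)⁻¹) ^ m / qfac p m) *
          (qh p) ^ (-(m : ℤ) + 2 * (m : ℤ) * (j : ℤ) + ((j : ℤ) + (p : ℤ) + 1) ^ 2)) •
        (Dphi p ^ m * De p ^ m * Dk p ^ (2 * j))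

/-- The Drinfeld element `u = Σ S(β_i) α_i` for `R = Σ α_i ⊗ β_i`,
depending on a choice of antipode `S`. -/
def drinfeldU (p : ℕ) (S : Dq p →ₗ[ℂ] Dq p) : Dq p :=
  LinearMap.mul' ℂ (Dq p) (TensorProduct.map S LinearMap.id (R21 p))

/-- `Δ` takes the prescribed values on the generators of `U`. -/
def IsDeltaU (p : ℕ) (Δ : Uq p →ₐ[ℂ] Uq p ⊗[ℂ] Uq p) : Prop :=
  Δ (UE p) = 1 ⊗ₜ[ℂ] UE p + UE p ⊗ₜ[ℂ] UK p ∧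
  Δ (UF p) = UKinv p ⊗ₜ[ℂ] UF p + UF p ⊗ₜ[ℂ] 1 ∧
  Δ (UK p) = UK p ⊗ₜ[ℂ] UK p ∧
  Δ (UKinv p) = UKinv p ⊗ₜ[ℂ] UKinv p

/-- `ε` takes the prescribed values on the generators of `U`. -/
def IsCounitU (p : ℕ) (ε : Uq p →ₐ[ℂ] ℂ) : Prop :=
  ε (UE p) = 0 ∧ ε (UF p) = 0 ∧ ε (UK p) = 1 ∧ ε (UKinv p) = 1

/-- `S` is an algebra anti-homomorphism taking the prescribed values on the
generators of `U`. -/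
def IsAntipodeU (p : ℕ) (S : Uq p →ₗ[ℂ] Uq p) : Prop :=
  S 1 = 1 ∧ (∀ x y, S (x * y) = S y * S x) ∧
  S (UE p) = -(UE p * UKinv p) ∧ S (UF p) = -(UK p * UF p) ∧
  S (UK p) = UKinv p ∧ S (UKinv p) = UK p

/-- `Δ` takes the prescribed values on the generators of `D`. -/
def IsDeltaD (p : ℕ) (Δ : Dq p →ₐ[ℂ] Dq p ⊗[ℂ] Dq p) : Prop :=
  Δ (De p) = 1 ⊗ₜ[ℂ] De p + De p ⊗ₜ[ℂ] (Dk p ^ 2) ∧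
  Δ (Dphi p) = (Dkinv p ^ 2) ⊗ₜ[ℂ] Dphi p + Dphi p ⊗ₜ[ℂ] 1 ∧
  Δ (Dk p) = Dk p ⊗ₜ[ℂ] Dk p ∧
  Δ (Dkinv p) = Dkinv p ⊗ₜ[ℂ] Dkinv p

/-- `ε` takes the prescribed values on the generators of `D`. -/
def IsCounitD (p : ℕ) (ε : Dq p →ₐ[ℂ] ℂ) : Prop :=
  ε (De p) = 0 ∧ ε (Dphi p) = 0 ∧ ε (Dk p) = 1 ∧ ε (Dkinv p) = 1

/-- `S` is an algebra anti-homomorphism taking the prescribed values on the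
generators of `D`. -/
def IsAntipodeD (p : ℕ) (S : Dq p →ₗ[ℂ] Dq p) : Prop :=
  S 1 = 1 ∧ (∀ x y, S (x * y) = S y * S x) ∧
  S (De p) = -(De p * Dkinv p ^ 2) ∧ S (Dphi p) = -(Dk p ^ 2 * Dphi p) ∧
  S (Dk p) = Dkinv p ∧ S (Dkinv p) = Dk p

/-- `ι` takes the prescribed values `E ↦ e`, `F ↦ φ`, `K^{±1} ↦ k^{±2}`. -/
def IsIota (p : ℕ) (ι : Uq p →ₐ[ℂ] Dq p) : Prop :=
  ι (UE p) = De p ∧ ι (UF p) = Dphi p ∧ ι (UK p) = Dk p ^ 2 ∧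
  ι (UKinv p) = Dkinv p ^ 2

/-- `μ` takes the prescribed values on the PBW basis of `U`. -/
def IsMu (p : ℕ) (μ : Uq p →ₗ[ℂ] ℂ) : Prop :=
  ∀ m n l : ℕ, m < p → n < p → l < 2 * p →
    μ (UE p ^ m * UF p ^ n * UK p ^ l) =
      if m = p - 1 ∧ n = p - 1 ∧ l = p + 1 then
        -((Real.sqrt (2 / (p : ℝ)) : ℂ)) * (qfac p (p - 1)) ^ 2
      else 0

variable {A : Type*} [Ring A] [Algebra ℂ A]

/-- Coassociativity of a comultiplication. -/
def Coassoc (Δ : A →ₐ[ℂ] A ⊗[ℂ] A) : Prop :=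
  ∀ x, TensorProduct.assoc ℂ A A A
      (TensorProduct.map Δ.toLinearMap LinearMap.id (Δ x)) =
    TensorProduct.map LinearMap.id Δ.toLinearMap (Δ x)

/-- The counit axiom. -/
def CounitAxiom (Δ : A →ₐ[ℂ] A ⊗[ℂ] A) (ε : A →ₐ[ℂ] ℂ) : Prop :=
  (∀ x, TensorProduct.lid ℂ A
      (TensorProduct.map ε.toLinearMap LinearMap.id (Δ x)) = x) ∧
  (∀ x, TensorProduct.rid ℂ A
      (TensorProduct.map LinearMap.id ε.toLinearMap (Δ x)) = x)

/-- The antipode axiom. -/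
def AntipodeAxiom (Δ : A →ₐ[ℂ] A ⊗[ℂ] A) (ε : A →ₐ[ℂ] ℂ)
    (S : A →ₗ[ℂ] A) : Prop :=
  (∀ x, LinearMap.mul' ℂ A (TensorProduct.map S LinearMap.id (Δ x)) = ε x • 1) ∧
  (∀ x, LinearMap.mul' ℂ A (TensorProduct.map LinearMap.id S (Δ x)) = ε x • 1)

/-- `x ↦ x ⊗ 1`. -/
def e1 (p : ℕ) : Dq p →ₗ[ℂ] Dq p ⊗[ℂ] Dq p :=
  (TensorProduct.mk ℂ (Dq p) (Dq p)).flip 1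

/-- `x ↦ 1 ⊗ x`. -/
def e2 (p : ℕ) : Dq p →ₗ[ℂ] Dq p ⊗[ℂ] Dq p :=
  TensorProduct.mk ℂ (Dq p) (Dq p) 1

/-- The balancing element `g = K^{p+1}`. -/
def gU (p : ℕ) : Uq p := UK p ^ (p + 1)

/-- The span of commutators `[U,U]`. -/
def commSpan (p : ℕ) : Submodule ℂ (Uq p) :=
  Submodule.span ℂ {z : Uq p | ∃ x y : Uq p, z = x * y - y * x}

section aux

/-- Abstract data: an algebra generated by `E, F, K` with the relations of the restricted quantum group. -/
structure QRel {A : Type*} [Ring A] [Algebra ℂ A] (p : ℕ) (r c : ℂ) (E F K : A) : Prop where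
  hp : 2 ≤ p
  hr0 : r ≠ 0
  hr : r ^ p = 1
  Ep : E ^ p = 0
  Fp : F ^ p = 0
  Kp : K ^ (2 * p) = 1
  KE : K * E = r • (E * K)
  KF : K * F = r⁻¹ • (F * K)
  FE : F * E = E * F - c • (K - K ^ (2 * p - 1))
  gen : ∀ T : Subalgebra ℂ A, E ∈ T → F ∈ T → K ∈ T → T = ⊤

variable {A : Type*} [Ring A] [Algebra ℂ A] {p : ℕ} {r c : ℂ} {E F K : A}

theorem pow_comm_aux {s : ℂ} {X Y : A} (h : X * Y = s • (Y * X)) (a : ℕ) :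
    X ^ a * Y = s ^ a • (Y * X ^ a) := by
  induction a with
  | zero => simp
  | succ a ih =>
    rw [pow_succ, mul_assoc, h, mul_smul_comm, ← mul_assoc, ih, smul_mul_assoc, smul_smul,
      mul_assoc, ← pow_succ, pow_succ' s]

theorem pow_comm_aux2 {s : ℂ} {X Y : A} (h : X * Y = s • (Y * X)) (a b : ℕ) :
    X ^ a * Y ^ b = s ^ (a * b) • (Y ^ b * X ^ a) := by
  induction b with
  | zero => simp
  | succ b ih =>
    rw [pow_succ, ← mul_assoc, ih, smul_mul_assoc, mul_assoc, pow_comm_aux h, mul_smul_comm,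
      smul_smul, mul_assoc, Nat.mul_succ, pow_add]

namespace QRel

theorem F_Epow (H : QRel p r c E F K) (m : ℕ) : ∃ a b : ℂ,
    F * E ^ (m + 1) = E ^ (m + 1) * F + E ^ m * (a • K + b • K ^ (2 * p - 1)) := by
  induction m with
  | zero =>
    refine ⟨-c, c, ?_⟩
    simp only [zero_add, pow_one, pow_zero, one_mul]
    rw [H.FE, smul_sub]; simp only [neg_smul]; abel
  | succ m ih =>
    obtain ⟨a, b, h⟩ := ih
    refine ⟨a * r - c, b * r ^ (2 * p - 1) + c, ?_⟩
    rw [pow_succ E (m + 1), ← mul_assoc, h, add_mul, mul_assoc, H.FE, mul_assoc, add_mul,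
      smul_mul_assoc, smul_mul_assoc, H.KE, pow_comm_aux H.KE, mul_sub, ← mul_assoc, pow_succ E m]
    simp only [smul_smul, smul_sub, add_smul, sub_smul, mul_add, mul_sub, mul_smul_comm, mul_assoc]
    abel

theorem Fpow_E (H : QRel p r c E F K) (n : ℕ) : ∃ a b : ℂ,
    F ^ (n + 1) * E = E * F ^ (n + 1) + F ^ n * (a • K + b • K ^ (2 * p - 1)) := by
  induction n with
  | zero =>
    refine ⟨-c, c, ?_⟩
    simp only [zero_add, pow_one, pow_zero, one_mul]
    rw [H.FE, smul_sub]; simp only [neg_smul]; abel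
  | succ n ih =>
    obtain ⟨a, b, h⟩ := ih
    refine ⟨a - c * (r⁻¹) ^ (n + 1), b + c * (r⁻¹) ^ ((2 * p - 1) * (n + 1)), ?_⟩
    have h1 : K * F ^ (n + 1) = (r⁻¹) ^ (n + 1) • (F ^ (n + 1) * K) := by
      have := pow_comm_aux2 H.KF 1 (n + 1)
      simpa using this
    have h2 := pow_comm_aux2 H.KF (2 * p - 1) (n + 1)
    rw [pow_succ' F (n + 1), mul_assoc, h, mul_add, ← mul_assoc, H.FE, sub_mul, smul_mul_assoc,
      sub_mul, h1, h2, ← mul_assoc F (F ^ n), ← pow_succ']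
    simp only [smul_smul, smul_sub, add_smul, sub_smul, mul_add, mul_sub, mul_smul_comm, mul_assoc]
    abel

theorem Kpow_mod (H : QRel p r c E F K) (l : ℕ) : K ^ l = K ^ (l % (2 * p)) := by
  conv_lhs => rw [← Nat.div_add_mod l (2 * p), pow_add, pow_mul, H.Kp, one_pow, one_mul]

/-- the PBW span -/
def W (E F K : A) (p : ℕ) : Submodule ℂ A :=
  Submodule.span ℂ (Set.range fun t : Fin p × Fin p × Fin (2 * p) =>
    E ^ (t.1 : ℕ) * F ^ (t.2.1 : ℕ) * K ^ (t.2.2 : ℕ))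

theorem mem_W (H : QRel p r c E F K) (m n l : ℕ) : E ^ m * F ^ n * K ^ l ∈ W E F K p := by
  by_cases hm : m < p
  · by_cases hn : n < p
    · rw [H.Kpow_mod]
      have hp := H.hp
      exact Submodule.subset_span
        ⟨(⟨m, hm⟩, ⟨n, hn⟩, ⟨l % (2 * p), Nat.mod_lt _ (by omega)⟩), rfl⟩
    · rw [pow_eq_zero_of_le (not_lt.1 hn) H.Fp]; simp
  · rw [pow_eq_zero_of_le (not_lt.1 hm) H.Ep]; simp

theorem K_mon (H : QRel p r c E F K) (j m n l : ℕ) :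
    K ^ j * (E ^ m * F ^ n * K ^ l) =
      (r ^ (j * m) * r⁻¹ ^ (j * n)) • (E ^ m * F ^ n * K ^ (j + l)) := by
  rw [← mul_assoc, ← mul_assoc, pow_comm_aux2 H.KE, smul_mul_assoc, mul_assoc (E ^ m),
    pow_comm_aux2 H.KF, mul_smul_comm, smul_smul, smul_mul_assoc, ← mul_assoc, mul_assoc _ (K ^ j),
    ← pow_add]

theorem K_Fmon (H : QRel p r c E F K) (j n l : ℕ) :
    K ^ j * (F ^ n * K ^ l) = r⁻¹ ^ (j * n) • (F ^ n * K ^ (j + l)) := by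
  have := H.K_mon j 0 n l
  simpa using this

/-- F times a monomial -/
theorem F_mon (H : QRel p r c E F K) (m n l : ℕ) : ∃ a b : ℂ,
    F * (E ^ (m + 1) * F ^ n * K ^ l) = E ^ (m + 1) * F ^ (n + 1) * K ^ l +
      (a • (E ^ m * F ^ n * K ^ (1 + l)) + b • (E ^ m * F ^ n * K ^ (2 * p - 1 + l))) := by
  obtain ⟨a, b, h⟩ := H.F_Epow m
  refine ⟨a * r⁻¹ ^ (1 * n), b * r⁻¹ ^ ((2 * p - 1) * n), ?_⟩
  have h1 := H.K_Fmon 1 n l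
  rw [pow_one] at h1
  rw [mul_assoc (E ^ (m + 1)), ← mul_assoc F, h, add_mul, mul_assoc (E ^ (m + 1)) F,
    ← mul_assoc F, ← pow_succ', mul_assoc (E ^ m), add_mul, smul_mul_assoc, smul_mul_assoc, h1,
    H.K_Fmon]
  simp only [smul_smul, mul_add, mul_smul_comm, mul_assoc]

theorem W_eq_top (H : QRel p r c E F K) : W E F K p = ⊤ := by
  let T : Subalgebra ℂ A :=
    { carrier := {x | ∀ w ∈ W E F K p, x * w ∈ W E F K p}
      mul_mem' := fun {a b} ha hb w hw => by
        rw [mul_assoc]; exact ha _ (hb _ hw)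
      add_mem' := fun {a b} ha hb w hw => by
        rw [add_mul]; exact add_mem (ha _ hw) (hb _ hw)
      algebraMap_mem' := fun s w hw => by
        rw [← Algebra.smul_def]; exact Submodule.smul_mem _ _ hw }
  have key : ∀ x : A, (∀ m n l : ℕ, x * (E ^ m * F ^ n * K ^ l) ∈ W E F K p) → x ∈ T := by
    intro x hx w hw
    refine Submodule.span_induction (p := fun w _ => x * w ∈ W E F K p) ?_ ?_ ?_ ?_ hw
    · rintro _ ⟨t, rfl⟩; exact hx _ _ _
    · simp
    · intro a b _ _ ha hb; rw [mul_add]; exact add_mem ha hb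
    · intro s a _ ha; rw [mul_smul_comm]; exact Submodule.smul_mem _ _ ha
  have hT : T = ⊤ := by
    apply H.gen
    · apply key; intro m n l
      rw [← mul_assoc, ← mul_assoc, ← pow_succ']; exact H.mem_W _ _ _
    · apply key; intro m n l
      cases m with
      | zero =>
        have := H.mem_W 0 (n + 1) l
        simpa [pow_succ', mul_assoc] using this
      | succ m =>
        obtain ⟨a, b, h⟩ := H.F_mon m n l
        rw [h]
        exact add_mem (H.mem_W _ _ _) (add_mem (Submodule.smul_mem _ _ (H.mem_W _ _ _))
          (Submodule.smul_mem _ _ (H.mem_W _ _ _)))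
    · apply key; intro m n l
      have := H.K_mon 1 m n l
      rw [pow_one] at this
      rw [this]; exact Submodule.smul_mem _ _ (H.mem_W _ _ _)
  rw [eq_top_iff]
  intro x _
  have hx : x ∈ T := by rw [hT]; trivial
  have h1 : (1 : A) ∈ W E F K p := by simpa using H.mem_W 0 0 0
  simpa using hx 1 h1

/-- functional vanishing on a spanning set -/
theorem ext_W (H : QRel p r c E F K) {f g : A →ₗ[ℂ] ℂ}
    (h : ∀ m n l : ℕ, f (E ^ m * F ^ n * K ^ l) = g (E ^ m * F ^ n * K ^ l)) : f = g := by
  apply LinearMap.ext_on H.W_eq_top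
  rintro _ ⟨t, rfl⟩
  exact h _ _ _

/-- the abstract version of `IsMu` -/
def Mu (p : ℕ) (E F K : A) (ζ : ℂ) (μ : A →ₗ[ℂ] ℂ) : Prop :=
  ∀ m n l : ℕ, m < p → n < p → l < 2 * p →
    μ (E ^ m * F ^ n * K ^ l) = if m = p - 1 ∧ n = p - 1 ∧ l = p + 1 then ζ else 0

theorem mu_eq (H : QRel p r c E F K) {ζ : ℂ} {μ : A →ₗ[ℂ] ℂ} (hμ : Mu p E F K ζ μ) (m n l : ℕ) :
    μ (E ^ m * F ^ n * K ^ l) =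
      if m = p - 1 ∧ n = p - 1 ∧ l % (2 * p) = p + 1 then ζ else 0 := by
  have hp := H.hp
  by_cases hm : m < p
  · by_cases hn : n < p
    · rw [H.Kpow_mod, hμ _ _ _ hm hn (Nat.mod_lt _ (by omega))]
    · rw [pow_eq_zero_of_le (not_lt.1 hn) H.Fp, if_neg (by omega)]; simp
  · rw [pow_eq_zero_of_le (not_lt.1 hm) H.Ep, if_neg (by omega)]; simp

theorem rpow_eq (H : QRel p r c E F K) {l : ℕ} (h : l % (2 * p) = p + 1) : r ^ l = r := by
  rw [← Nat.div_add_mod l (2 * p), h, pow_add, pow_mul, mul_comm 2 p, pow_mul, H.hr, pow_succ r p, H.hr]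
  simp

theorem mu_K (H : QRel p r c E F K) {ζ : ℂ} {μ : A →ₗ[ℂ] ℂ} (hμ : Mu p E F K ζ μ) (x : A) :
    μ (x * K) = μ (K * x) := by
  have : μ ∘ₗ LinearMap.mulRight ℂ K = μ ∘ₗ LinearMap.mulLeft ℂ K := by
    apply H.ext_W
    intro m n l
    have h := H.K_mon 1 m n l
    rw [pow_one] at h
    simp only [LinearMap.comp_apply, LinearMap.mulRight_apply, LinearMap.mulLeft_apply]
    rw [h, mul_assoc, ← pow_succ, map_smul, H.mu_eq hμ, H.mu_eq hμ, add_comm 1 l]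
    split_ifs with h1
    · obtain ⟨rfl, rfl, _⟩ := h1
      have : r ^ (1 * (p - 1)) * r⁻¹ ^ (1 * (p - 1)) = 1 := by
        rw [← mul_pow, mul_inv_cancel₀ H.hr0, one_pow]
      rw [this, one_smul]
    · simp
  exact LinearMap.congr_fun this x

theorem mu_E (H : QRel p r c E F K) {ζ : ℂ} {μ : A →ₗ[ℂ] ℂ} (hμ : Mu p E F K ζ μ) (x : A) :
    μ (x * E) = μ ((r • E) * x) := by
  have hp := H.hp
  have : μ ∘ₗ LinearMap.mulRight ℂ E = μ ∘ₗ LinearMap.mulLeft ℂ (r • E) := by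
    apply H.ext_W
    intro m n l
    simp only [LinearMap.comp_apply, LinearMap.mulRight_apply, LinearMap.mulLeft_apply]
    rw [smul_mul_assoc, map_smul, ← mul_assoc, ← mul_assoc, ← pow_succ', H.mu_eq hμ,
      mul_assoc, pow_comm_aux H.KE, mul_smul_comm, map_smul]
    have h2 : μ (E ^ m * F ^ n * (E * K ^ l)) = μ (E ^ (m + 1) * F ^ n * K ^ l) := by
      cases n with
      | zero => simp [pow_succ, mul_assoc]
      | succ n =>
        obtain ⟨a, b, h⟩ := H.Fpow_E n
        have : E ^ m * F ^ (n + 1) * (E * K ^ l) = E ^ (m + 1) * F ^ (n + 1) * K ^ l +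
            (a • (E ^ m * F ^ n * K ^ (1 + l)) + b • (E ^ m * F ^ n * K ^ (2 * p - 1 + l))) := by
          rw [mul_assoc, ← mul_assoc (F ^ (n + 1)), h, pow_succ E m, pow_add K 1, pow_add K (2 * p - 1), pow_one]
          simp only [add_mul, mul_add, smul_mul_assoc, mul_smul_comm, mul_assoc]
        rw [this, map_add, map_add, map_smul, map_smul]
        by_cases hn : n = p - 1
        · have h0 : n + 1 = p := by omega
          have e1 : E ^ m * F ^ (n + 1) * (E * K ^ l) = 0 := by rw [h0, H.Fp]; simp
          rw [← map_smul, ← map_smul, ← map_add, ← map_add, ← this, e1, h0, H.Fp]; simp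
        · rw [H.mu_eq hμ m n, H.mu_eq hμ m n, if_neg (by tauto), if_neg (by tauto)]; simp
    rw [h2, H.mu_eq hμ]
    split_ifs with h1
    · rw [H.rpow_eq h1.2.2]
    · simp
  exact LinearMap.congr_fun this x

theorem mu_F (H : QRel p r c E F K) {ζ : ℂ} {μ : A →ₗ[ℂ] ℂ} (hμ : Mu p E F K ζ μ) (x : A) :
    μ (x * F) = μ ((r⁻¹ • F) * x) := by
  have hp := H.hp
  have : μ ∘ₗ LinearMap.mulRight ℂ F = μ ∘ₗ LinearMap.mulLeft ℂ (r⁻¹ • F) := by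
    apply H.ext_W
    intro m n l
    simp only [LinearMap.comp_apply, LinearMap.mulRight_apply, LinearMap.mulLeft_apply]
    have h2 : μ (F * (E ^ m * F ^ n * K ^ l)) = μ (E ^ m * F ^ (n + 1) * K ^ l) := by
      cases m with
      | zero => simp [pow_succ', mul_assoc]
      | succ m =>
        obtain ⟨a, b, this⟩ := H.F_mon m n l
        rw [this, map_add, map_add, map_smul, map_smul]
        by_cases hn : m = p - 1
        · have h0 : m + 1 = p := by omega
          have e1 : F * (E ^ (m + 1) * F ^ n * K ^ l) = 0 := by rw [h0, H.Ep]; simp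
          rw [← map_smul, ← map_smul, ← map_add, ← map_add, ← this, e1, h0, H.Ep]; simp
        · rw [H.mu_eq hμ m n, H.mu_eq hμ m n, if_neg (by tauto), if_neg (by tauto)]; simp
    rw [smul_mul_assoc, map_smul, h2, mul_assoc, pow_comm_aux H.KF, mul_smul_comm, map_smul,
      ← mul_assoc, mul_assoc (E ^ m), ← pow_succ, H.mu_eq hμ]
    split_ifs with h1
    · rw [inv_pow, H.rpow_eq h1.2.2]
    · simp
  exact LinearMap.congr_fun this x

theorem mu_q (H : QRel p r c E F K) {ζ : ℂ} {μ : A →ₗ[ℂ] ℂ} (hμ : Mu p E F K ζ μ)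
    {σ : A →ₗ[ℂ] A} (h1 : σ 1 = 1) (hm : ∀ x y, σ (x * y) = σ x * σ y) (hE : σ E = r • E)
    (hF : σ F = r⁻¹ • F) (hK : σ K = K) (x y : A) : μ (x * y) = μ (σ y * x) := by
  let T : Subalgebra ℂ A :=
    { carrier := {y | ∀ x, μ (x * y) = μ (σ y * x)}
      mul_mem' := fun {a b} ha hb x => by
        rw [← mul_assoc, hb, ← mul_assoc, ha, hm, mul_assoc]
      add_mem' := fun {a b} ha hb x => by
        rw [mul_add, map_add, ha, hb, map_add, add_mul, map_add]
      algebraMap_mem' := fun s x => by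
        rw [Algebra.algebraMap_eq_smul_one, map_smul, h1]; simp }
  have hT : T = ⊤ := by
    apply H.gen
    · intro x; rw [hE]; exact H.mu_E hμ x
    · intro x; rw [hF]; exact H.mu_F hμ x
    · intro x; rw [hK]; exact H.mu_K hμ x
  have : y ∈ T := by rw [hT]; trivial
  exact this x

theorem nondeg (H : QRel p r c E F K) {ζ : ℂ} (hζ : ζ ≠ 0) {μ : A →ₗ[ℂ] ℂ} (hμ : Mu p E F K ζ μ)
    (z : A) (hz : ∀ x y, μ (x * z * y) = 0) : z = 0 := by
  have hp := H.hp
  have hzW : z ∈ W E F K p := by rw [H.W_eq_top]; trivial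
  obtain ⟨f, hf⟩ := (Submodule.mem_span_range_iff_exists_fun ℂ).1 hzW
  rw [← hf]
  apply Finset.sum_eq_zero
  intro t _
  suffices f t = 0 by rw [this, zero_smul]
  obtain ⟨m, n, l⟩ := t
  have h := hz (E ^ (p - 1 - m)) (F ^ (p - 1 - n) * K ^ (3 * p + 1 - l))
  rw [← hf, Finset.mul_sum, Finset.sum_mul, map_sum, Finset.sum_eq_single (m, n, l)] at h
  all_goals
    have gen : ∀ s : Fin p × Fin p × Fin (2 * p),
      μ (E ^ (p - 1 - m.1) * (f s • (E ^ s.1.1 * F ^ s.2.1.1 * K ^ s.2.2.1)) *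
        (F ^ (p - 1 - n.1) * K ^ (3 * p + 1 - l.1))) = f s * (r⁻¹ ^ (s.2.2.1 * (p - 1 - n.1)) *
          if p - 1 - m.1 + s.1.1 = p - 1 ∧ s.2.1.1 + (p - 1 - n.1) = p - 1 ∧
            (s.2.2.1 + (3 * p + 1 - l.1)) % (2 * p) = p + 1 then ζ else 0) := by
      intro s
      rw [mul_smul_comm, smul_mul_assoc, map_smul, smul_eq_mul]
      congr 1
      have : E ^ (p - 1 - m.1) * (E ^ s.1.1 * F ^ s.2.1.1 * K ^ s.2.2.1) *
        (F ^ (p - 1 - n.1) * K ^ (3 * p + 1 - l.1)) = r⁻¹ ^ (s.2.2.1 * (p - 1 - n.1)) •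
          (E ^ (p - 1 - m.1 + s.1.1) * F ^ (s.2.1.1 + (p - 1 - n.1)) *
            K ^ (s.2.2.1 + (3 * p + 1 - l.1))) := by
        rw [mul_assoc, mul_assoc (E ^ s.1.1 * F ^ s.2.1.1), H.K_Fmon, pow_add E, pow_add F]
        simp only [mul_smul_comm, mul_assoc]
      rw [this, map_smul, smul_eq_mul, H.mu_eq hμ]
  · have := gen (m, n, l)
    rw [if_pos (by
      have := m.2; have := n.2; have := l.2
      refine ⟨?_, ?_, ?_⟩
      · dsimp only; omega
      · dsimp only; omega
      · dsimp only
        rw [show (l : ℕ) + (3 * p + 1 - l) = p + 1 + 2 * p by omega, Nat.add_mod_right,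
          Nat.mod_eq_of_lt (by omega)])] at this
    rw [this] at h
    have h3 : r⁻¹ ^ (l.1 * (p - 1 - n.1)) ≠ 0 := pow_ne_zero _ (inv_ne_zero H.hr0)
    simpa [hζ, H.hr0] using h
  · rintro ⟨m', n', l'⟩ _ hne
    rw [gen, if_neg]
    · simp
    · rintro ⟨h1, h2, h3⟩
      apply hne
      have := m.2; have := n.2; have := l.2
      have := m'.2; have := n'.2; have := l'.2
      dsimp only at h1 h2 h3
      have e1 : m' = m := by ext; omega
      have e2 : n' = n := by ext; omega
      have e3 : l' = l := by
        ext
        have h4 : ((l' : ℕ) + (3 * p + 1 - l)) % (2 * p) = ((l : ℕ) + (3 * p + 1 - l)) % (2 * p) := by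
          rw [h3, show (l : ℕ) + (3 * p + 1 - l) = p + 1 + 2 * p by omega, Nat.add_mod_right,
            Nat.mod_eq_of_lt (by omega)]
        have h5 : (l' : ℕ) ≡ l [MOD 2 * p] := Nat.ModEq.add_right_cancel' _ h4
        exact Nat.ModEq.eq_of_lt_of_lt h5 l'.2 l.2
      rw [e1, e2, e3]
  · intro h; exact absurd (Finset.mem_univ _) h

theorem main (H : QRel p r c E F K) {ζ : ℂ} (hζ : ζ ≠ 0) {μ : A →ₗ[ℂ] ℂ} (hμ : Mu p E F K ζ μ)
    {σ : A →ₗ[ℂ] A} (h1 : σ 1 = 1) (hm : ∀ x y, σ (x * y) = σ x * σ y) (hE : σ E = r • E)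
    (hF : σ F = r⁻¹ • F) (hK : σ K = K) :
      Function.Injective (fun z : Subalgebra.center ℂ A =>
        μ ∘ₗ LinearMap.mulLeft ℂ (z : A)) ∧
      Set.range (fun z : Subalgebra.center ℂ A =>
          μ ∘ₗ LinearMap.mulLeft ℂ (z : A)) =
        {φ : Module.Dual ℂ A | ∀ x y, φ (x * y) = φ (σ y * x)} := by
  have hq := H.mu_q hμ h1 hm hE hF hK
  have nd : ∀ z : A, (∀ x, μ (z * x) = 0) → z = 0 := by
    intro z hz
    apply H.nondeg hζ hμ z
    intro x y
    have hx : ∃ x', σ x' = x := by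
      have hT : (AlgHom.ofLinearMap σ h1 hm).range = ⊤ := by
        apply H.gen
        · exact ⟨r⁻¹ • E, by simp [hE, smul_smul, H.hr0]⟩
        · exact ⟨r • F, by simp [hF, smul_smul, H.hr0]⟩
        · exact ⟨K, by simp [hK]⟩
      have : x ∈ (AlgHom.ofLinearMap σ h1 hm).range := by rw [hT]; trivial
      obtain ⟨x', h⟩ := this
      exact ⟨x', h⟩
    obtain ⟨x', rfl⟩ := hx
    rw [mul_assoc, ← hq, mul_assoc, hz]
  have hfin : FiniteDimensional ℂ A := by
    refine Module.finite_def.2 ?_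
    rw [← H.W_eq_top]
    exact Submodule.fg_span (Set.finite_range _)
  let L : A →ₗ[ℂ] Module.Dual ℂ A := (LinearMap.mul ℂ A).compr₂ μ
  have hL : ∀ z x, L z x = μ (z * x) := fun z x => rfl
  have hLinj : Function.Injective L := by
    rw [injective_iff_map_eq_zero]
    intro z hz
    apply nd
    intro x
    rw [← hL, hz]; rfl
  have hLsurj : Function.Surjective L :=
    (LinearMap.injective_iff_surjective_of_finrank_eq_finrank
      (Subspace.dual_finrank_eq (K := ℂ) (V := A)).symm).1 hLinj
  refine ⟨?_, ?_⟩
  · intro z z' h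
    apply Subtype.ext
    apply hLinj
    exact h
  · ext φ
    constructor
    · rintro ⟨z, rfl⟩ x y
      have hz := Subalgebra.mem_center_iff.1 z.2
      simp only [LinearMap.comp_apply, LinearMap.mulLeft_apply]
      rw [← mul_assoc, hq, ← mul_assoc, ← mul_assoc, hz]
    · intro h
      obtain ⟨z, rfl⟩ := hLsurj φ
      have hc : ∀ y, σ y * z = z * σ y := by
        intro y
        rw [← sub_eq_zero]
        apply nd
        intro x
        have h2 := h x y
        rw [hL, hL, ← mul_assoc, hq] at h2
        rw [sub_mul, map_sub, mul_assoc, h2, mul_assoc, sub_self]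
      have hT : Subalgebra.centralizer ℂ {z} = ⊤ := by
        apply H.gen
        · have := hc (r⁻¹ • E)
          rw [map_smul, hE, smul_smul, inv_mul_cancel₀ H.hr0, one_smul] at this
          rw [Subalgebra.mem_centralizer_iff]; rintro _ rfl; exact this.symm
        · have := hc (r • F)
          rw [map_smul, hF, smul_smul, mul_inv_cancel₀ H.hr0, one_smul] at this
          rw [Subalgebra.mem_centralizer_iff]; rintro _ rfl; exact this.symm
        · have := hc K
          rw [hK] at this
          rw [Subalgebra.mem_centralizer_iff]; rintro _ rfl; exact this.symm
      refine ⟨⟨z, ?_⟩, rfl⟩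
      rw [Subalgebra.mem_center_iff]
      intro b
      have hb : b ∈ Subalgebra.centralizer ℂ {z} := by rw [hT]; trivial
      exact ((Subalgebra.mem_centralizer_iff ℂ).1 hb z rfl).symm

end QRel

theorem neg_aux1 (k e i : A) : -(k * -(e * i)) = k * e * i := by noncomm_ring

theorem neg_aux2 (k e i : A) : -(-(k * e) * i) = k * e * i := by noncomm_ring

theorem qq_prim (p : ℕ) (hp : 2 ≤ p) : IsPrimitiveRoot (qq p) (2 * p) := by
  have := Complex.isPrimitiveRoot_exp (2 * p) (by omega)
  convert this using 1
  rw [qq]; congr 1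
  have : (p : ℂ) ≠ 0 := by exact_mod_cast (by omega : p ≠ 0)
  push_cast; field_simp

theorem qnum_ne (p m : ℕ) (hp : 2 ≤ p) (h0 : 0 < m) (hm : m < p) : qnum p m ≠ 0 := by
  have hP := qq_prim p hp
  have hq0 : qq p ≠ 0 := Complex.exp_ne_zero _
  have key : ∀ k, 0 < k → k < p → qq p ^ k - (qq p)⁻¹ ^ k ≠ 0 := by
    intro k hk hk' h
    rw [sub_eq_zero, inv_pow] at h
    have h2 : qq p ^ (2 * k) = 1 := by
      rw [two_mul, pow_add]
      nth_rw 1 [h]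
      exact inv_mul_cancel₀ (pow_ne_zero _ hq0)
    exact hP.pow_ne_one_of_pos_of_lt (by omega) (by omega) h2
  have h1 := key 1 one_pos (by omega)
  rw [pow_one, pow_one] at h1
  exact div_ne_zero (key m h0 hm) h1

theorem qfac_ne (p m : ℕ) (hp : 2 ≤ p) (hm : m < p) : qfac p m ≠ 0 := by
  induction m with
  | zero => simp [qfac]
  | succ m ih => exact mul_ne_zero (qnum_ne p _ hp (by omega) hm) (ih (by omega))

theorem UKinv_mul (p : ℕ) : UKinv p * UK p = 1 := by
  have := RingQuot.mkAlgHom_rel ℂ (URel.KinvK (p := p))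
  simp only [map_mul, map_one] at this
  exact this

theorem UKp (p : ℕ) : UK p ^ (2 * p) = 1 := by
  have := RingQuot.mkAlgHom_rel ℂ (URel.Kpow (p := p))
  simp only [map_pow, map_one] at this
  exact this

theorem UKE (p : ℕ) : UK p * UE p * UKinv p = (qq p) ^ 2 • UE p := by
  have := RingQuot.mkAlgHom_rel ℂ (URel.KE (p := p))
  simp only [map_mul, map_smul] at this
  exact this

theorem UKF (p : ℕ) : UK p * UF p * UKinv p = ((qq p) ^ 2)⁻¹ • UF p := by
  have := RingQuot.mkAlgHom_rel ℂ (URel.KF (p := p))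
  simp only [map_mul, map_smul] at this
  exact this

theorem UEF (p : ℕ) :
    UE p * UF p - UF p * UE p = (qq p - (qq p)⁻¹)⁻¹ • (UK p - UKinv p) := by
  have := RingQuot.mkAlgHom_rel ℂ (URel.EF (p := p))
  simp only [map_mul, map_smul, map_sub] at this
  exact this

theorem UKinv_eq (p : ℕ) (hp : 2 ≤ p) : UKinv p = UK p ^ (2 * p - 1) := by
  have h : UK p * UK p ^ (2 * p - 1) = 1 := by
    rw [← pow_succ', Nat.sub_add_cancel (by omega), UKp]
  calc UKinv p = UKinv p * (UK p * UK p ^ (2 * p - 1)) := by rw [h, mul_one]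
    _ = _ := by rw [← mul_assoc, UKinv_mul, one_mul]

theorem Uq_rel (p : ℕ) (hp : 2 ≤ p) :
    QRel p ((qq p) ^ 2) ((qq p - (qq p)⁻¹)⁻¹) (UE p) (UF p) (UK p) where
  hp := hp
  hr0 := pow_ne_zero _ (Complex.exp_ne_zero _)
  hr := by rw [← pow_mul]; exact (qq_prim p hp).pow_eq_one
  Ep := by
    have := RingQuot.mkAlgHom_rel ℂ (URel.Epow (p := p))
    simp only [map_pow, map_zero] at this
    exact this
  Fp := by
    have := RingQuot.mkAlgHom_rel ℂ (URel.Fpow (p := p))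
    simp only [map_pow, map_zero] at this
    exact this
  Kp := UKp p
  KE := by
    rw [← smul_mul_assoc, ← UKE, mul_assoc _ (UKinv p), UKinv_mul, mul_one]
  KF := by
    rw [← smul_mul_assoc, ← UKF, mul_assoc _ (UKinv p), UKinv_mul, mul_one]
  FE := by
    rw [← UKinv_eq p hp, ← UEF]; abel
  gen := by
    intro T hE hF hK
    rw [eq_top_iff]
    intro x _
    obtain ⟨y, rfl⟩ := RingQuot.mkAlgHom_surjective ℂ (URel p) x
    induction y using FreeAlgebra.induction with
    | grade0 s => rw [AlgHom.commutes]; exact T.algebraMap_mem s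
    | grade1 g =>
      cases g with
      | E => exact hE
      | F => exact hF
      | K => exact hK
      | Kinv =>
        have : UKinv p ∈ T := by rw [UKinv_eq p hp]; exact T.pow_mem hK _
        exact this
    | mul a b ha hb => rw [map_mul]; exact T.mul_mem (ha trivial) (hb trivial)
    | add a b ha hb => rw [map_add]; exact T.add_mem (ha trivial) (hb trivial)

end aux

end LogHennings
open LogHennings in
/-- `qChar(U)` is a free rank-one module over the center `Z(U)` with basis `μ`:
`z ↦ μ(z ·)` is a bijection from `Z(U)` onto `qChar(U)`. -/
theorem qchar_free_over_center (p : ℕ) (hp : 2 ≤ p) :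
    ∀ (μ : Uq p →ₗ[ℂ] ℂ) (S : Uq p →ₗ[ℂ] Uq p), IsMu p μ → IsAntipodeU p S →
      Function.Injective (fun z : Subalgebra.center ℂ (Uq p) =>
        μ ∘ₗ LinearMap.mulLeft ℂ (z : Uq p)) ∧
      Set.range (fun z : Subalgebra.center ℂ (Uq p) =>
          μ ∘ₗ LinearMap.mulLeft ℂ (z : Uq p)) =
        {φ : Module.Dual ℂ (Uq p) | ∀ x y, φ (x * y) = φ (S (S y) * x)} := by
  intro μ S hμ hS
  obtain ⟨h1, hmul, hE, hF, hK, hKi⟩ := hS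
  have hζ : -((Real.sqrt (2 / (p : ℝ)) : ℂ)) * (qfac p (p - 1)) ^ 2 ≠ 0 := by
    refine mul_ne_zero (neg_ne_zero.2 ?_) (pow_ne_zero _ (qfac_ne p _ hp (by omega)))
    have : 0 < Real.sqrt (2 / (p : ℝ)) := by
      apply Real.sqrt_pos.2
      have : (0 : ℝ) < p := by exact_mod_cast (by omega : 0 < p)
      positivity
    exact_mod_cast this.ne'
  refine QRel.main (Uq_rel p hp) hζ (μ := μ) hμ (σ := S ∘ₗ S) ?_ ?_ ?_ ?_ ?_
  · simp only [LinearMap.comp_apply, h1]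
  · intro x y; simp only [LinearMap.comp_apply, hmul]
  · simp only [LinearMap.comp_apply]
    rw [hE, map_neg, hmul, hE, hKi]
    exact (neg_aux1 _ _ _).trans (UKE p)
  · simp only [LinearMap.comp_apply]
    rw [hF, map_neg, hmul, hF, hK]
    exact (neg_aux2 _ _ _).trans (UKF p)
  · simp only [LinearMap.comp_apply, hK, hKi]
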